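/- arXiv:2507.18306 — 3 statements merged into one kernel-verified Lean document; each statement's English description precedes it below -/
import Mathlib

section
/- For any finite simple graph G with minimum degree δ = δ(G) ≥ 2 and maximum degree Δ = Δ(G) ≥ 4⌊δ/2⌋, the 2-coalition number satisfies C_2(G) ≤ (Δ − 2⌊δ/2⌋ + 1)(⌊δ/2⌋ + 1) + ⌈δ/2⌉ + 1. -/
open SimpleGraph

/-- A set `S` is a `k`-dominating set of `G` if every vertex outside `S`
has at least `k` neighbors in `S`. -/
def KDominatingSet {V : Type*} (G : SimpleGraph V) (k : ℕ) (S : Set V) : Prop :=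
  ∀ v ∉ S, k ≤ (S ∩ G.neighborSet v).ncard

/-- Two disjoint sets `A` and `B` form a `k`-coalition in `G` if neither is a
`k`-dominating set of `G` but their union is. -/
def KCoalition {V : Type*} (G : SimpleGraph V) (k : ℕ) (A B : Set V) : Prop :=
  Disjoint A B ∧ ¬ KDominatingSet G k A ∧ ¬ KDominatingSet G k B ∧
    KDominatingSet G k (A ∪ B)

/-- A `k`-coalition partition of `G` is a partition of the vertex set in which every
part is either a `k`-dominating set of cardinality `k` or forms a `k`-coalition with
another part. -/
def KCoalitionPartition {V : Type*} (G : SimpleGraph V) (k : ℕ) (P : Finset (Set V)) : Prop :=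
  (∀ A ∈ P, A.Nonempty) ∧
  (P : Set (Set V)).PairwiseDisjoint id ∧
  (⋃ A ∈ P, A) = (Set.univ : Set V) ∧
  ∀ A ∈ P, (KDominatingSet G k A ∧ A.ncard = k) ∨
    ∃ B ∈ P, B ≠ A ∧ KCoalition G k A B

/-- The `k`-coalition number of `G`: the maximum cardinality of a
`k`-coalition partition of `G`. -/
noncomputable def kCoalitionNumber {V : Type*} (G : SimpleGraph V) (k : ℕ) : ℕ :=
  sSup {n | ∃ P : Finset (Set V), KCoalitionPartition G k P ∧ P.card = n}

section helpers

open Finset in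
lemma abs_E_bound {ι : Type*} (P X H J E : Finset ι) (w : ι → ℕ) (Δ : ℕ)
    (hsum : ∑ A ∈ P, w A ≤ Δ + 2) (hH : H ⊆ P) (hX : X ⊆ P) (hHX : Disjoint H X)
    (hJ : ∀ A, A ∈ J ↔ A ∈ H ∧ w A ≤ 1) (hEX : E ⊆ X) (hJne : J.Nonempty)
    (hE : ∀ B ∈ E, ∃ A ∈ J, 2 ≤ w A + w B) (hd : 2 * H.card ≤ Δ + 1) :
    E.card + 2 * H.card ≤ Δ + 1 + 2 * J.card := by
  classical
  have hJH : J ⊆ H := fun A hA => ((hJ A).1 hA).1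
  have h1 : ∑ A ∈ H, w A + ∑ A ∈ E, w A ≤ Δ + 2 := by
    rw [← Finset.sum_union (Finset.disjoint_of_subset_right hEX hHX)]
    exact (Finset.sum_le_sum_of_subset (Finset.union_subset hH (hEX.trans hX))).trans hsum
  have h2 : ∑ A ∈ H \ J, w A + ∑ A ∈ J, w A = ∑ A ∈ H, w A := Finset.sum_sdiff hJH
  have h3 : (H \ J).card * 2 ≤ ∑ A ∈ H \ J, w A := by
    rw [← smul_eq_mul]
    apply Finset.card_nsmul_le_sum
    intro A hA
    rw [Finset.mem_sdiff, hJ] at hA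
    by_contra hc
    exact hA.2 ⟨hA.1, by omega⟩
  have h4 : (H \ J).card + J.card = H.card := Finset.card_sdiff_add_card_eq_card hJH
  have h5 : 1 ≤ J.card := hJne.card_pos
  by_cases hz : ∑ A ∈ J, w A = 0
  · have hz' := Finset.sum_eq_zero_iff.1 hz
    have h6 : E.card * 2 ≤ ∑ A ∈ E, w A := by
      rw [← smul_eq_mul]
      apply Finset.card_nsmul_le_sum
      intro B hB
      obtain ⟨A, hA, hAB⟩ := hE B hB
      have := hz' A hA
      omega
    omega
  · have h6 : E.card * 1 ≤ ∑ A ∈ E, w A := by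
      rw [← smul_eq_mul]
      apply Finset.card_nsmul_le_sum
      intro B hB
      obtain ⟨A, hA, hAB⟩ := hE B hB
      have := ((hJ A).1 hA).2
      omega
    omega

lemma abs_bound {V ι : Type*} (P : Finset ι) (w : V → ι → ℕ) (Δ δ : ℕ) (v : V)
    (hδ : 2 ≤ δ) (hΔ : 4 * (δ / 2) ≤ Δ)
    (hsum : ∀ u, ∑ A ∈ P, w u A ≤ Δ + 2) (hv : ∑ A ∈ P, w v A ≤ δ + 2)
    (hP : ∀ A ∈ P, (∀ u, 2 ≤ w u A) ∨ ∃ B ∈ P, (∃ u, w u B < 2) ∧ ∀ u, 2 ≤ w u A + w u B) :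
    P.card ≤ (Δ - 2 * (δ / 2) + 1) * (δ / 2 + 1) + (δ + 1) / 2 + 1 := by
  classical
  set H := P.filter (fun A => 2 ≤ w v A) with hH
  set L := P.filter (fun A => w v A = 1) with hL
  set X := P.filter (fun A => w v A = 0) with hX
  have hHX : Disjoint H X := by
    rw [Finset.disjoint_left]; intro A hA hA'
    simp only [hH, hX, Finset.mem_filter] at hA hA'; omega
  have hHL : Disjoint H L := by
    rw [Finset.disjoint_left]; intro A hA hA'
    simp only [hH, hL, Finset.mem_filter] at hA hA'; omega
  have hPc : P.card ≤ H.card + L.card + X.card := by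
    have : P ⊆ (H ∪ L) ∪ X := by
      intro A hA
      simp only [hH, hX, hL, Finset.mem_filter, Finset.mem_union, hA, true_and]; omega
    exact (Finset.card_le_card this).trans ((Finset.card_union_le _ _).trans
      (Nat.add_le_add_right (Finset.card_union_le _ _) _))
  have hHL2 : 2 * H.card + L.card ≤ δ + 2 := by
    have h1 : H.card * 2 ≤ ∑ A ∈ H, w v A := by
      rw [← smul_eq_mul]
      exact Finset.card_nsmul_le_sum _ _ _ (fun A hA => (Finset.mem_filter.1 hA).2)
    have h2 : L.card * 1 ≤ ∑ A ∈ L, w v A := by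
      rw [← smul_eq_mul]
      exact Finset.card_nsmul_le_sum _ _ _ (fun A hA => (Finset.mem_filter.1 hA).2.ge)
    have h3 : ∑ A ∈ H, w v A + ∑ A ∈ L, w v A ≤ δ + 2 := by
      rw [← Finset.sum_union hHL]
      exact (Finset.sum_le_sum_of_subset
        (Finset.union_subset (Finset.filter_subset _ _) (Finset.filter_subset _ _))).trans hv
    omega
  obtain ⟨d, hd⟩ : ∃ d, d + 2 * H.card = Δ + 1 := ⟨Δ + 1 - 2 * H.card, by omega⟩
  let J : V → Finset ι := fun u => H.filter (fun A => w u A ≤ 1)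
  let E : V → Finset ι := fun u => X.filter (fun B => ∃ A ∈ J u, ∀ z, 2 ≤ w z B + w z A)
  have hE : ∀ u, (J u).Nonempty → (E u).card ≤ d + 2 * (J u).card := by
    intro u hu
    have := abs_E_bound P X H (J u) (E u) (w u) Δ (hsum u) (Finset.filter_subset _ _)
      (Finset.filter_subset _ _) hHX (fun A => Finset.mem_filter) (Finset.filter_subset _ _) hu
      (by
        intro B hB
        obtain ⟨A, hA, h⟩ := (Finset.mem_filter.1 hB).2
        exact ⟨A, hA, by have := h u; omega⟩) (by omega)
    omega
  have hXc : X.card ≤ H.card * (d + 2) := by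
    let H' := H.filter (fun A => ∃ u, w u A < 2)
    have hf : ∀ A, ∃ u, A ∈ H' → w u A < 2 := by
      intro A
      by_cases h : A ∈ H'
      · obtain ⟨u, hu⟩ := (Finset.mem_filter.1 h).2
        exact ⟨u, fun _ => hu⟩
      · exact ⟨v, fun h' => absurd h' h⟩
    choose f hf using hf
    have hself : ∀ A ∈ H', A ∈ J (f A) := fun A hA =>
      Finset.mem_filter.2 ⟨(Finset.mem_filter.1 hA).1, by have := hf A hA; omega⟩
    have hpart : ∀ B ∈ X, ∃ A ∈ H', ∀ z, 2 ≤ w z B + w z A := by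
      intro B hB
      obtain ⟨hBP, hB0⟩ := Finset.mem_filter.1 hB
      rcases hP B hBP with h | ⟨A, hA, hn, h⟩
      · have := h v; omega
      · refine ⟨A, Finset.mem_filter.2 ⟨Finset.mem_filter.2 ⟨hA, ?_⟩, hn⟩, h⟩
        have := h v; omega
    rcases H'.eq_empty_or_nonempty with he | hne
    · have : X = ∅ := by
        apply Finset.eq_empty_of_forall_notMem
        intro B hB
        obtain ⟨A, hA, _⟩ := hpart B hB
        simp [he] at hA
      rw [this]; simp
    · obtain ⟨A0, hA0, hmax⟩ := Finset.exists_max_image H' (fun A => (J (f A)).card) hne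
      set S := (J (f A0)).card with hS
      have hbd : ∀ A ∈ H', (E (f A)).card ≤ d + 2 * S := by
        intro A hA
        have h1 := hE (f A) ⟨A, hself A hA⟩
        have h2 := hmax A hA
        omega
      have hsub : X ⊆ E (f A0) ∪ (H' \ J (f A0)).biUnion (fun A => E (f A)) := by
        intro B hB
        obtain ⟨A, hA, h⟩ := hpart B hB
        by_cases hj : A ∈ J (f A0)
        · exact Finset.mem_union_left _ (Finset.mem_filter.2 ⟨hB, A, hj, h⟩)
        · exact Finset.mem_union_right _ (Finset.mem_biUnion.2
            ⟨A, Finset.mem_sdiff.2 ⟨hA, hj⟩, Finset.mem_filter.2 ⟨hB, A, hself A hA, h⟩⟩)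
      have hJH : J (f A0) ⊆ H := Finset.filter_subset _ _
      have h1 : X.card ≤ (d + 2 * S) + (H' \ J (f A0)).card * (d + 2 * S) := by
        refine (Finset.card_le_card hsub).trans ((Finset.card_union_le _ _).trans
          (Nat.add_le_add (hbd A0 hA0) ?_))
        exact Finset.card_biUnion_le_card_mul _ _ _
          (fun A hA => hbd A (Finset.mem_sdiff.1 hA).1)
      have h2 : (H' \ J (f A0)).card ≤ (H \ J (f A0)).card :=
        Finset.card_le_card (Finset.sdiff_subset_sdiff (Finset.filter_subset _ _) le_rfl)
      have h3 : (H \ J (f A0)).card + S = H.card := Finset.card_sdiff_add_card_eq_card hJH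
      have h4 : 1 ≤ S := Finset.card_pos.2 ⟨A0, hself A0 hA0⟩
      have h5 : 2 * H.card ≤ d + 3 := by omega
      generalize (H \ J (f A0)).card = m at *
      have h6 : X.card ≤ (d + 2 * S) + m * (d + 2 * S) :=
        h1.trans (Nat.add_le_add_left (Nat.mul_le_mul_right _ h2) _)
      refine h6.trans ?_
      rw [← h3]
      obtain ⟨s, hs⟩ : ∃ s, S = s + 1 := ⟨S - 1, by omega⟩
      rw [hs] at h3 ⊢
      rcases Nat.eq_zero_or_pos s with h0 | h0
      · subst h0; apply le_of_eq; ring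
      · have h7 : 2 * m ≤ d := by omega
        nlinarith [Nat.mul_le_mul_left s h7]
  clear_value H L X
  generalize H.card = n at *
  generalize L.card = l at *
  generalize X.card = x at *
  obtain ⟨h, e, he, hδe⟩ : ∃ h e, e ≤ 1 ∧ δ = 2 * h + e := ⟨δ / 2, δ % 2, by omega, by omega⟩
  have hh : δ / 2 = h := by omega
  have hc : (δ + 1) / 2 = h + e := by omega
  rw [hh] at hΔ ⊢
  rw [hc]
  obtain ⟨q, hq⟩ : ∃ q, Δ = 4 * h + q := ⟨Δ - 4 * h, by omega⟩
  have hsub : Δ - 2 * h + 1 = 2 * h + q + 1 := by omega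
  rw [hsub]
  have hn : n ≤ h + 1 := by omega
  obtain ⟨k, hk⟩ : ∃ k, h + 1 = n + k := ⟨h + 1 - n, by omega⟩
  have hd2 : d = 2 * h + q + 2 * k - 1 := by omega
  obtain rfl | hn0 := Nat.eq_zero_or_pos n
  · nlinarith
  have hd3 : d + 1 = 2 * h + q + 2 * k := by omega
  have hx : x ≤ n * (2 * h + q + 2 * k + 1) := by
    have : d + 2 = 2 * h + q + 2 * k + 1 := by omega
    rwa [this] at hXc
  have : n + l ≤ h + e + 1 + k := by omega
  obtain ⟨t, rfl⟩ : ∃ t, n = t + 1 := ⟨n - 1, by omega⟩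
  have hht : h = t + k := by omega
  subst hht
  rcases Nat.eq_zero_or_pos k with rfl | hk0
  · nlinarith
  · nlinarith [Nat.mul_le_mul_left k hk0, Nat.zero_le (k * q)]

open Classical in
/-- domination weight -/
noncomputable def domW {V : Type*} (G : SimpleGraph V) (u : V) (A : Set V) : ℕ :=
  (A ∩ G.neighborSet u).ncard + if u ∈ A then 2 else 0

lemma dom_iff {V : Type*} (G : SimpleGraph V) (A : Set V) :
    KDominatingSet G 2 A ↔ ∀ u, 2 ≤ domW G u A := by
  unfold KDominatingSet domW
  refine forall_congr' fun u => ?_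
  by_cases h : u ∈ A <;> simp [h]

lemma domW_union {V : Type*} [Finite V] (G : SimpleGraph V) (u : V) (A B : Set V)
    (h : Disjoint A B) : domW G u (A ∪ B) = domW G u A + domW G u B := by
  unfold domW
  rw [Set.union_inter_distrib_right, Set.ncard_union_eq
    (h.mono Set.inter_subset_left Set.inter_subset_left) (Set.toFinite _) (Set.toFinite _)]
  rw [Set.disjoint_left] at h
  by_cases hA : u ∈ A
  · simp [hA, h hA]; ring
  · by_cases hB : u ∈ B <;> simp [hA, hB]; ring

lemma domW_biUnion {V : Type*} [Finite V] (G : SimpleGraph V) (u : V) (P : Finset (Set V))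
    (h : (P : Set (Set V)).PairwiseDisjoint id) :
    ∑ A ∈ P, domW G u A = domW G u (⋃ A ∈ P, A) := by
  classical
  induction P using Finset.induction_on with
  | empty => simp [domW]
  | insert A P hA ih =>
    rw [Finset.sum_insert hA, Finset.set_biUnion_insert, domW_union, ih]
    · exact h.subset (by simp)
    · simp only [Set.disjoint_iUnion_right]
      intro B hB
      exact h (by simp) (by simp [hB]) (by rintro rfl; exact hA hB)

lemma domW_univ {V : Type*} [Fintype V] (G : SimpleGraph V) [DecidableRel G.Adj] (u : V) :
    domW G u Set.univ = G.degree u + 2 := by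
  unfold domW
  rw [Set.univ_inter, Set.ncard_eq_toFinset_card', ← G.card_neighborSet_eq_degree,
    Set.toFinset_card]
  simp

end helpers

theorem c2_upper_bound {V : Type*} [Fintype V] (G : SimpleGraph V) [DecidableRel G.Adj]
    (hδ : 2 ≤ G.minDegree) (hΔ : 4 * (G.minDegree / 2) ≤ G.maxDegree) :
    kCoalitionNumber G 2 ≤
      (G.maxDegree - 2 * (G.minDegree / 2) + 1) * (G.minDegree / 2 + 1) +
        (G.minDegree + 1) / 2 + 1 := by
  unfold kCoalitionNumber
  rcases Set.eq_empty_or_nonempty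
    {n | ∃ P : Finset (Set V), KCoalitionPartition G 2 P ∧ P.card = n} with he | hne
  · rw [he]; simp
  apply csSup_le hne
  rintro n ⟨P, ⟨-, hdisj, hcov, hP⟩, rfl⟩
  have hV : Nonempty V := by
    by_contra hV
    rw [not_nonempty_iff] at hV
    have : G.minDegree = 0 := by simp [SimpleGraph.minDegree]
    omega
  obtain ⟨v, hv⟩ := G.exists_minimal_degree_vertex
  have hs : ∀ u, ∑ A ∈ P, domW G u A = G.degree u + 2 := by
    intro u
    rw [domW_biUnion G u P hdisj, hcov, domW_univ]
  refine abs_bound P (domW G) G.maxDegree G.minDegree v hδ hΔ ?_ ?_ ?_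
  · intro u
    rw [hs]
    have := G.degree_le_maxDegree u
    omega
  · rw [hs, hv]
  · intro A hA
    rcases hP A hA with ⟨h, -⟩ | ⟨B, hB, -, hd, -, hnB, hAB⟩
    · exact Or.inl ((dom_iff G A).1 h)
    · refine Or.inr ⟨B, hB, ?_, ?_⟩
      · rw [dom_iff] at hnB
        push Not at hnB
        exact hnB
      · intro u
        rw [← domW_union G u A B hd]
        exact (dom_iff G _).1 hAB u
end

section
/- For every even positive integer δ and every integer Δ ≥ 2δ, there exists a finite simple graph G with minimum degree δ(G) = δ and maximum degree Δ(G) = Δ such that C_2(G) = (Δ − 2⌊δ/2⌋ + 1)(⌊δ/2⌋ + 1) + ⌈δ/2⌉ + 1. -/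
open SimpleGraph

namespace C2

open Finset

/-- Abstract counting bound. -/
lemma abstract_bound {α V : Type*} [DecidableEq α] (P : Finset α) (w : V → α → ℕ) (x : V)
    (m D : ℕ) (hD : 4 * m ≤ D)
    (hx : ∑ S ∈ P, w x S ≤ 2 * m + 2)
    (hv : ∀ v, ∑ S ∈ P, w v S ≤ D + 2)
    (hP : ∀ B ∈ P, w x B = 0 → ∃ A ∈ P, (∀ v, 2 ≤ w v A + w v B) ∧ ∃ v, w v A ≤ 1) :
    P.card ≤ (m + 1) * (D - 2 * m + 2) := by
  classical
  set T0 := P.filter (fun B => w x B = 0) with hT0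
  set T1 := P.filter (fun B => ¬ w x B = 0) with hT1
  have hcard : P.card = T0.card + T1.card :=
    (Finset.card_filter_add_card_filter_not _).symm
  choose! f hfP hfd hfn using hP
  set H := T0.image f with hH
  have hT0P : ∀ B ∈ T0, B ∈ P ∧ w x B = 0 := fun B hB => by simpa [hT0] using hB
  have hH2 : ∀ A ∈ H, A ∈ P ∧ 2 ≤ w x A := by
    intro A hA
    obtain ⟨B, hB, rfl⟩ := Finset.mem_image.1 hA
    obtain ⟨h1, h2⟩ := hT0P B hB
    refine ⟨hfP B h1 h2, ?_⟩
    have := hfd B h1 h2 x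
    omega
  have hHT1 : H ⊆ T1 := by
    intro A hA
    have := hH2 A hA
    simp only [hT1, Finset.mem_filter]
    exact ⟨this.1, by omega⟩
  have hT1H : T1.card + H.card ≤ 2 * m + 2 := by
    have e1 : ∑ S ∈ T1, (1 + if S ∈ H then 1 else 0) ≤ ∑ S ∈ T1, w x S := by
      refine Finset.sum_le_sum fun S hS => ?_
      have hne : ¬ w x S = 0 := (Finset.mem_filter.1 hS).2
      split_ifs with h
      · exact (hH2 S h).2
      · omega
    have e2 : ∑ S ∈ T1, w x S ≤ ∑ S ∈ P, w x S :=
      Finset.sum_le_sum_of_subset (Finset.filter_subset _ _)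
    have e3 : ∑ S ∈ T1, (1 + if S ∈ H then 1 else 0) = T1.card + H.card := by
      rw [Finset.sum_add_distrib, Finset.sum_ite_mem, Finset.inter_eq_right.2 hHT1]
      simp
    omega
  have hHle : H.card ≤ T1.card := Finset.card_le_card hHT1
  have hfib : ∀ A ∈ H, (T0.filter (fun B => f B = A)).card ≤ D + 3 - 2 * H.card := by
    intro A hA
    obtain ⟨B0, hB0, hB0A⟩ := Finset.mem_image.1 hA
    obtain ⟨v, hvA⟩ := hfn B0 (hT0P B0 hB0).1 (hT0P B0 hB0).2
    rw [hB0A] at hvA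
    have hg : ∀ A ∈ H, ∃ B ∈ T0, f B = A := fun A hA => by simpa [hH] using hA
    choose! g hgT hgf using hg
    set F := T0.filter (fun B => f B = A) with hF
    set K := H.erase A with hK
    have hginj : Set.InjOn g K := by
      intro a ha b hb hab
      have ha' := Finset.mem_of_mem_erase ha
      have hb' := Finset.mem_of_mem_erase hb
      rw [← hgf a ha', ← hgf b hb', hab]
    have hd1 : Disjoint (K.image g) F := by
      rw [Finset.disjoint_left]
      intro B hB hBF
      obtain ⟨a, ha, rfl⟩ := Finset.mem_image.1 hB
      have h1 := hgf a (Finset.mem_of_mem_erase ha)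
      have h2 := (Finset.mem_filter.1 hBF).2
      exact Finset.ne_of_mem_erase ha (h1 ▸ h2)
    have hsub : K.image g ∪ F ⊆ T0 := by
      refine Finset.union_subset ?_ (Finset.filter_subset _ _)
      intro B hB
      obtain ⟨a, ha, rfl⟩ := Finset.mem_image.1 hB
      exact hgT a (Finset.mem_of_mem_erase ha)
    have hd2 : Disjoint T0 H := by
      rw [Finset.disjoint_left]
      intro B hB hBH
      have := (hT0P B hB).2
      have := (hH2 B hBH).2
      omega
    have hsum : ∑ S ∈ T0, w v S + ∑ S ∈ H, w v S ≤ D + 2 := by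
      rw [← Finset.sum_union hd2]
      refine le_trans (Finset.sum_le_sum_of_subset ?_) (hv v)
      exact Finset.union_subset (Finset.filter_subset _ _) (fun a ha => (hH2 a ha).1)
    have hsum0 : ∑ S ∈ K, w v (g S) + ∑ S ∈ F, w v S ≤ ∑ S ∈ T0, w v S := by
      rw [← Finset.sum_image (f := fun S => w v S) hginj, ← Finset.sum_union hd1]
      exact Finset.sum_le_sum_of_subset hsub
    have hsumH : ∑ S ∈ H, w v S = ∑ S ∈ K, w v S + w v A :=
      (Finset.sum_erase_add _ _ hA).symm
    have hKK : 2 * K.card ≤ ∑ S ∈ K, w v S + ∑ S ∈ K, w v (g S) := by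
      rw [← Finset.sum_add_distrib, mul_comm, ← smul_eq_mul]
      refine Finset.card_nsmul_le_sum _ _ _ fun a ha => ?_
      have ha' := Finset.mem_of_mem_erase ha
      have h0 := hT0P _ (hgT a ha')
      have := hfd _ h0.1 h0.2 v
      rwa [hgf a ha'] at this
    have hFF : F.card * (2 - w v A) ≤ ∑ S ∈ F, w v S := by
      rw [← smul_eq_mul]
      refine Finset.card_nsmul_le_sum _ _ _ fun B hB => ?_
      obtain ⟨hB1, hB2⟩ := Finset.mem_filter.1 hB
      have h0 := hT0P _ hB1
      have := hfd _ h0.1 h0.2 v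
      rw [hB2] at this
      omega
    have hKc : K.card + 1 = H.card := Finset.card_erase_add_one hA
    have hFpos : 0 < F.card := Finset.card_pos.2 ⟨B0, Finset.mem_filter.2 ⟨hB0, hB0A⟩⟩
    rcases Nat.le_one_iff_eq_zero_or_eq_one.1 hvA with h | h
    · rw [h] at hFF hsumH
      omega
    · rw [h] at hFF hsumH
      omega
  have hT0c : T0.card ≤ H.card * (D + 3 - 2 * H.card) := by
    rw [Finset.card_eq_sum_card_image f T0, ← smul_eq_mul]
    exact Finset.sum_le_card_nsmul _ _ _ hfib
  rw [hcard]
  have hh : H.card ≤ m + 1 := by omega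
  generalize H.card = h at *
  obtain ⟨e, rfl⟩ := Nat.exists_eq_add_of_le hD
  obtain ⟨c, hc⟩ := Nat.exists_eq_add_of_le hh
  have e1 : 4 * m + e + 3 - 2 * h = 2 * m + 1 + e + 2 * c := by omega
  have e2 : 4 * m + e - 2 * m + 2 = 2 * m + e + 2 := by omega
  rw [e1] at hT0c
  rw [e2]
  have hT1c : T1.card ≤ 2 * m + 2 - h := by omega
  have : T1.card + h ≤ 2 * m + 2 := hT1H
  rcases Nat.eq_zero_or_pos c with rfl | hcp
  · have : h = m + 1 := by omega
    subst this
    nlinarith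
  · obtain ⟨c', rfl⟩ : ∃ c', c = c' + 1 := ⟨c - 1, by omega⟩
    obtain rfl : m = h + c' := by omega
    nlinarith [Nat.zero_le (c' * e), Nat.zero_le e]

open Classical in
/-- weight of a set `S` seen from `v` -/
noncomputable def wt {V : Type*} [Fintype V] (G : SimpleGraph V) (v : V) (S : Set V) : ℕ :=
  ∑ u : V, ((if G.Adj v u then 1 else 0) + (if u = v then 2 else 0)) * (if u ∈ S then 1 else 0)

lemma wt_eq {V : Type*} [Fintype V] (G : SimpleGraph V) (v : V) (S : Set V) :
    wt G v S = (S ∩ G.neighborSet v).ncard + (open Classical in if v ∈ S then 2 else 0) := by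
  classical
  have : (S ∩ G.neighborSet v).ncard = (univ.filter (fun u => u ∈ S ∧ G.Adj v u)).card := by
    rw [← Set.ncard_coe_finset]
    congr 1
    ext u
    simp
  rw [this, wt, Finset.card_filter]
  simp only [add_mul, Finset.sum_add_distrib]
  congr 1
  · refine Finset.sum_congr rfl fun u _ => ?_
    by_cases h1 : G.Adj v u <;> by_cases h2 : u ∈ S <;> simp [h1, h2]
  · rw [Finset.sum_eq_single v] <;> simp +contextual

lemma kdom_iff {V : Type*} [Fintype V] (G : SimpleGraph V) (S : Set V) :
    KDominatingSet G 2 S ↔ ∀ v, 2 ≤ wt G v S := by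
  classical
  unfold KDominatingSet
  refine forall_congr' fun v => ?_
  rw [wt_eq]
  by_cases h : v ∈ S <;> simp [h]

lemma wt_union {V : Type*} [Fintype V] (G : SimpleGraph V) (v : V) (A B : Set V) :
    wt G v (A ∪ B) ≤ wt G v A + wt G v B := by
  classical
  unfold wt
  rw [← Finset.sum_add_distrib]
  refine Finset.sum_le_sum fun u _ => ?_
  rw [← mul_add]
  refine Nat.mul_le_mul_left _ ?_
  by_cases h1 : u ∈ A <;> by_cases h2 : u ∈ B <;> simp [h1, h2]

lemma wt_sum {V : Type*} [Fintype V] (G : SimpleGraph V) [DecidableRel G.Adj] (v : V)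
    (P : Finset (Set V)) (hP : (P : Set (Set V)).PairwiseDisjoint id) :
    ∑ S ∈ P, wt G v S ≤ G.degree v + 2 := by
  classical
  unfold wt
  rw [Finset.sum_comm]
  have key : ∀ u : V, ∑ S ∈ P, (if u ∈ S then 1 else 0) ≤ 1 := by
    intro u
    rw [← Finset.card_filter, Finset.card_le_one]
    intro A hA B hB
    simp only [Finset.mem_filter] at hA hB
    by_contra hne
    exact Set.disjoint_left.1 (hP hA.1 hB.1 hne) hA.2 hB.2
  calc _ ≤ ∑ u : V, ((if G.Adj v u then 1 else 0) + (if u = v then 2 else 0)) := by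
        refine Finset.sum_le_sum fun u _ => ?_
        rw [← Finset.mul_sum]
        exact (Nat.mul_le_mul_left _ (key u)).trans (by rw [mul_one]; apply le_of_eq; congr)
    _ = G.degree v + 2 := by
        rw [Finset.sum_add_distrib, ← Finset.card_filter, ← SimpleGraph.card_neighborFinset_eq_degree]
        congr 1
        · congr 1
          ext u
          simp
        · simp

lemma upper {V : Type*} [Fintype V] (G : SimpleGraph V) [DecidableRel G.Adj] (m D : ℕ)
    (hD : 4 * m ≤ D) (x : V) (hx : G.degree x = 2 * m) (hmax : ∀ v, G.degree v ≤ D)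
    (P : Finset (Set V)) (hP : KCoalitionPartition G 2 P) :
    P.card ≤ (m + 1) * (D - 2 * m + 2) := by
  classical
  obtain ⟨-, hdis, -, hco⟩ := hP
  refine abstract_bound P (wt G) x m D hD ?_ ?_ ?_
  · exact hx ▸ wt_sum G x P hdis
  · intro v
    exact (wt_sum G v P hdis).trans (by have := hmax v; omega)
  · intro B hB hB0
    rcases hco B hB with ⟨h, -⟩ | ⟨A, hA, -, -, hnB, hnA, hAB⟩
    · rw [kdom_iff] at h
      have := h x
      omega
    · refine ⟨A, hA, fun v => ?_, ?_⟩
      · rw [kdom_iff] at hAB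
        have := (hAB v).trans (wt_union G v B A)
        omega
      · rw [kdom_iff] at hnA
        push Not at hnA
        obtain ⟨v, hv⟩ := hnA
        exact ⟨v, by omega⟩

/-- vertices: gadget vertices `(i,j,l,s)`, partners `(i,j)`, witnesses `i` -/
abbrev W (I J : Type) := (I × J × I × Bool) ⊕ ((I × J) ⊕ I)

/-- adjacency -/
def adj {I J : Type} (σ : I → I) (j0 : J) : W I J → W I J → Prop
  | .inl (i, j, l, _), .inl (i', j', l', _) => i = i' ∧ j = j' ∧ l ≠ l'
  | .inl (i, j, l, s), .inr (.inl (i', j')) => i = i' ∧ j = j' ∧ ¬ (l = σ i ∧ s = true)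
  | .inr (.inl (i', j')), .inl (i, j, l, s) => i = i' ∧ j = j' ∧ ¬ (l = σ i ∧ s = true)
  | .inl (i, j, l, s), .inr (.inr i') =>
      i = i' ∧ j = j0 ∧ ((l ≠ i ∧ l ≠ σ i) ∨ (l = i ∧ s = false))
  | .inr (.inr i'), .inl (i, j, l, s) =>
      i = i' ∧ j = j0 ∧ ((l ≠ i ∧ l ≠ σ i) ∨ (l = i ∧ s = false))
  | .inr (.inl (i, _)), .inr (.inr i') => i = i'
  | .inr (.inr i'), .inr (.inl (i, _)) => i = i'
  | .inr (.inl _), .inr (.inl _) => False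
  | .inr (.inr _), .inr (.inr _) => False

/-- the graph -/
def gr {I J : Type} (σ : I → I) (j0 : J) : SimpleGraph (W I J) where
  Adj := adj σ j0
  symm := ⟨by
    rintro (⟨i, j, l, s⟩ | ⟨i, j⟩ | i) (⟨i', j', l', s'⟩ | ⟨i', j'⟩ | i') h <;>
      simp only [adj] at h ⊢ <;> grind⟩
  loopless := ⟨by
    rintro (⟨i, j, l, s⟩ | ⟨i, j⟩ | i) h <;> simp [adj] at h⟩

lemma gr_adj {I J : Type} (σ : I → I) (j0 : J) (a b : W I J) :
    (gr σ j0).Adj a b ↔ adj σ j0 a b := Iff.rfl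

section
variable {I J : Type} [Fintype I] [Fintype J] [DecidableEq I] [DecidableEq J]
  (σ : I → I) (j0 : J) [DecidableRel (gr σ j0).Adj]

lemma deg_g_le (i : I) (j : J) (l : I) (s : Bool) :
    (gr σ j0).degree (.inl (i, j, l, s)) ≤ 2 * (Fintype.card I - 1) + 2 := by
  rw [← SimpleGraph.card_neighborFinset_eq_degree]
  have hsub : (gr σ j0).neighborFinset (.inl (i, j, l, s)) ⊆
      (((univ.erase l) ×ˢ (univ : Finset Bool)).image
        (fun p => (Sum.inl (i, j, p.1, p.2) : W I J))) ∪
      {.inr (.inl (i, j)), .inr (.inr i)} := by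
    rintro (⟨i', j', l', s'⟩ | ⟨i', j'⟩ | i') h <;>
      simp [gr_adj, adj] at h ⊢ <;> grind
  refine (Finset.card_le_card hsub).trans ((Finset.card_union_le _ _).trans ?_)
  refine Nat.add_le_add (Finset.card_image_le.trans ?_) Finset.card_le_two
  simp [Finset.card_product, Finset.card_erase_of_mem, mul_comm]

lemma deg_x_le (i : I) (hσ : σ i ≠ i) :
    (gr σ j0).degree (.inl (i, j0, σ i, true)) ≤ 2 * (Fintype.card I - 1) := by
  rw [← SimpleGraph.card_neighborFinset_eq_degree]
  have hsub : (gr σ j0).neighborFinset (.inl (i, j0, σ i, true)) ⊆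
      (((univ.erase (σ i)) ×ˢ (univ : Finset Bool)).image
        (fun p => (Sum.inl (i, j0, p.1, p.2) : W I J))) := by
    rintro (⟨i', j', l', s'⟩ | ⟨i', j'⟩ | i') h <;>
      simp [gr_adj, adj] at h ⊢ <;> grind
  refine (Finset.card_le_card hsub).trans (Finset.card_image_le.trans ?_)
  simp [Finset.card_product, Finset.card_erase_of_mem, mul_comm]

lemma le_deg_g (i : I) (j : J) (l : I) (s : Bool) :
    2 * (Fintype.card I - 1) ≤ (gr σ j0).degree (.inl (i, j, l, s)) := by
  rw [← SimpleGraph.card_neighborFinset_eq_degree]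
  have hsub : (((univ.erase l) ×ˢ (univ : Finset Bool)).image
        (fun p => (Sum.inl (i, j, p.1, p.2) : W I J))) ⊆
      (gr σ j0).neighborFinset (.inl (i, j, l, s)) := by
    rintro (⟨i', j', l', s'⟩ | ⟨i', j'⟩ | i') h <;>
      simp [gr_adj, adj] at h ⊢ <;> grind
  refine le_trans ?_ (Finset.card_le_card hsub)
  rw [Finset.card_image_of_injective]
  · simp [Finset.card_product, Finset.card_erase_of_mem, mul_comm]
  · rintro ⟨a, b⟩ ⟨c, d⟩ h
    simpa using h

lemma le_deg_b (i : I) (j : J) :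
    2 * (Fintype.card I - 1) ≤ (gr σ j0).degree (.inr (.inl (i, j))) := by
  rw [← SimpleGraph.card_neighborFinset_eq_degree]
  have hsub : (((univ.erase (σ i)) ×ˢ (univ : Finset Bool)).image
        (fun p => (Sum.inl (i, j, p.1, p.2) : W I J))) ⊆
      (gr σ j0).neighborFinset (.inr (.inl (i, j))) := by
    rintro (⟨i', j', l', s'⟩ | ⟨i', j'⟩ | i') h <;>
      simp [gr_adj, adj] at h ⊢ <;> grind
  refine le_trans ?_ (Finset.card_le_card hsub)
  rw [Finset.card_image_of_injective]
  · simp [Finset.card_product, Finset.card_erase_of_mem, mul_comm]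
  · rintro ⟨a, b⟩ ⟨c, d⟩ h
    simpa using h

lemma deg_b_le (i : I) (j : J) :
    (gr σ j0).degree (.inr (.inl (i, j))) ≤ 2 * (Fintype.card I - 1) + 2 := by
  rw [← SimpleGraph.card_neighborFinset_eq_degree]
  have hsub : (gr σ j0).neighborFinset (.inr (.inl (i, j))) ⊆
      (((univ.erase (σ i)) ×ˢ (univ : Finset Bool)).image
        (fun p => (Sum.inl (i, j, p.1, p.2) : W I J))) ∪
      {.inl (i, j, σ i, false), .inr (.inr i)} := by
    rintro (⟨i', j', l', s'⟩ | ⟨i', j'⟩ | i') h <;>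
      simp [gr_adj, adj] at h ⊢ <;> grind
  refine (Finset.card_le_card hsub).trans ((Finset.card_union_le _ _).trans ?_)
  refine Nat.add_le_add (Finset.card_image_le.trans ?_) Finset.card_le_two
  simp [Finset.card_product, Finset.card_erase_of_mem, mul_comm]

lemma deg_v (i : I) (hσ : σ i ≠ i) :
    (gr σ j0).degree (.inr (.inr i)) = Fintype.card J + (2 * (Fintype.card I - 2) + 1) := by
  rw [← SimpleGraph.card_neighborFinset_eq_degree]
  have hE : (gr σ j0).neighborFinset (.inr (.inr i)) =
      ((univ : Finset J).image (fun j => (Sum.inr (.inl (i, j)) : W I J))) ∪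
      (insert (i, false) (((univ.erase i).erase (σ i)) ×ˢ (univ : Finset Bool))).image
        (fun p => (Sum.inl (i, j0, p.1, p.2) : W I J)) := by
    ext a
    rcases a with ⟨i', j', l', s'⟩ | ⟨i', j'⟩ | i' <;>
      simp [gr_adj, adj] <;> grind
  rw [hE, Finset.card_union_of_disjoint, Finset.card_image_of_injective,
    Finset.card_image_of_injective, Finset.card_insert_of_notMem, Finset.card_product,
    Finset.card_erase_of_mem, Finset.card_erase_of_mem]
  · simp only [Finset.card_univ, Fintype.card_bool]
    rw [mul_comm, Nat.sub_sub]
  · simp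
  · simp [hσ]
  · simp
  · rintro ⟨a, b⟩ ⟨c, d⟩ h
    simpa using h
  · intro a b h
    simpa using h
  · rw [Finset.disjoint_left]
    intro a h1 h2
    simp only [Finset.mem_image] at h1 h2
    obtain ⟨_, _, rfl⟩ := h1
    obtain ⟨_, _, h⟩ := h2
    cases h

end

/-- the part index of a vertex -/
def part {I J : Type} (σ : I → I) : W I J → I ⊕ (I × J)
  | .inl (_, _, l, _) => .inl l
  | .inr (.inl p) => .inr p
  | .inr (.inr i) => .inl (σ i)

/-- the part -/
def fib {I J : Type} (σ : I → I) (c : I ⊕ (I × J)) : Set (W I J) := {a | part σ a = c}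

lemma two_le {V : Type*} [Finite V] {S : Set V} {a b : V} (ha : a ∈ S) (hb : b ∈ S)
    (hab : a ≠ b) : 2 ≤ S.ncard := by
  have := (Set.one_lt_ncard_iff (S.toFinite)).2 ⟨a, b, ha, hb, hab⟩
  omega

section
variable {I J : Type} [Fintype I] [Fintype J] [DecidableEq I] [DecidableEq J]

lemma coal (σ : I → I) (j0 : J) (hσ : ∀ i, σ i ≠ i) (i : I) (j : J) :
    KCoalition (gr σ j0) 2 (fib σ (.inl i)) (fib σ (.inr (i, j))) := by
  refine ⟨?_, ?_, ?_, ?_⟩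
  · rw [Set.disjoint_left]
    intro a h1 h2
    simp only [fib, Set.mem_ofPred_eq] at h1 h2
    rw [h1] at h2
    cases h2
  · intro h
    have h1 := h (.inr (.inr i)) (by simp [fib, part, hσ i])
    have h2 : fib σ (.inl i) ∩ (gr σ j0).neighborSet (.inr (.inr i)) ⊆
        {(.inl (i, j0, i, false) : W I J)} := by
      rintro (⟨i', j', l', s'⟩ | ⟨i', j'⟩ | i') h <;>
        simp [gr_adj, adj, fib, part] at h ⊢ <;> grind
    have h3 := Set.ncard_le_ncard h2
    rw [Set.ncard_singleton] at h3
    omega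
  · intro h
    have h1 := h (.inr (.inr i)) (by simp [fib, part])
    have h2 : fib σ (.inr (i, j)) ∩ (gr σ j0).neighborSet (.inr (.inr i)) ⊆
        {(.inr (.inl (i, j)) : W I J)} := by
      rintro (⟨i', j', l', s'⟩ | ⟨i', j'⟩ | i') h <;>
        simp [gr_adj, adj, fib, part] at h ⊢ <;> grind
    have h3 := Set.ncard_le_ncard h2
    rw [Set.ncard_singleton] at h3
    omega
  · rintro (⟨i', j', l', s'⟩ | ⟨i', j'⟩ | i') h <;> simp [fib, part] at h
    · refine two_le (a := .inl (i', j', i, false)) (b := .inl (i', j', i, true)) ?_ ?_ (by simp) <;>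
        simp [gr_adj, adj, fib, part, h]
    · by_cases hi : i = σ i'
      · refine two_le (a := .inl (i', j', i, false)) (b := .inr (.inr i')) ?_ ?_ (by simp) <;>
          simp [gr_adj, adj, fib, part, hi]
      · refine two_le (a := .inl (i', j', i, false)) (b := .inl (i', j', i, true)) ?_ ?_
          (by simp) <;>
          simp [gr_adj, adj, fib, part, hi]
    · by_cases hi : i = i'
      · subst hi
        refine two_le (a := .inl (i, j0, i, false)) (b := .inr (.inl (i, j))) ?_ ?_ (by simp) <;>
          simp [gr_adj, adj, fib, part]
      · refine two_le (a := .inl (i', j0, i, false)) (b := .inl (i', j0, i, true)) ?_ ?_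
          (by simp) <;>
          simp [gr_adj, adj, fib, part, hi, Ne.symm h]

lemma fib_ne (σ : I → I) (j0 : J) (c : I ⊕ (I × J)) : (fib σ c).Nonempty := by
  rcases c with l | p
  · exact ⟨.inl (l, j0, l, false), rfl⟩
  · exact ⟨.inr (.inl p), rfl⟩

lemma fib_inj (σ : I → I) (j0 : J) :
    Function.Injective (fib σ : I ⊕ (I × J) → Set (W I J)) := by
  intro c c' h
  obtain ⟨a, ha⟩ := fib_ne σ j0 c
  have ha' : a ∈ fib σ c' := h ▸ ha
  exact Eq.trans (Eq.symm ha) ha'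

lemma lower (σ : I → I) (j0 : J) (hσ : ∀ i, σ i ≠ i) :
    ∃ P : Finset (Set (W I J)), KCoalitionPartition (gr σ j0) 2 P ∧
    P.card = Fintype.card I + Fintype.card I * Fintype.card J := by
  classical
  refine ⟨(univ : Finset (I ⊕ (I × J))).image (fib σ), ⟨?_, ?_, ?_, ?_⟩, ?_⟩
  · intro A hA
    obtain ⟨c, -, rfl⟩ := Finset.mem_image.1 hA
    exact fib_ne σ j0 c
  · intro A hA B hB hne
    obtain ⟨c, -, rfl⟩ := Finset.mem_image.1 (Finset.mem_coe.1 hA)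
    obtain ⟨c', -, rfl⟩ := Finset.mem_image.1 (Finset.mem_coe.1 hB)
    refine Set.disjoint_left.2 fun a h1 h2 => hne ?_
    have : c = c' := Eq.trans (Eq.symm h1) h2
    rw [this]
  · refine Set.eq_univ_of_forall fun a => ?_
    simp only [Set.mem_iUnion]
    exact ⟨fib σ (part σ a), Finset.mem_image_of_mem _ (Finset.mem_univ _), rfl⟩
  · intro A hA
    right
    obtain ⟨c, -, rfl⟩ := Finset.mem_image.1 hA
    rcases c with i | ⟨i, j⟩
    · refine ⟨fib σ (.inr (i, j0)), Finset.mem_image_of_mem _ (Finset.mem_univ _), ?_,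
        coal σ j0 hσ i j0⟩
      exact fun h => by cases fib_inj σ j0 h
    · obtain ⟨h1, h2, h3, h4⟩ := coal σ j0 hσ i j
      refine ⟨fib σ (.inl i), Finset.mem_image_of_mem _ (Finset.mem_univ _), ?_,
        h1.symm, h3, h2, Set.union_comm _ _ ▸ h4⟩
      exact fun h => by cases fib_inj σ j0 h
  · rw [Finset.card_image_of_injective _ (fib_inj σ j0)]
    simp

end

end C2

theorem exists_graph_c2_eq (d D : ℕ) (hde : Even d) (hdpos : 0 < d) (hD : 2 * d ≤ D) :
    ∃ (V : Type) (_ : Fintype V) (G : SimpleGraph V) (_ : DecidableRel G.Adj),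
      G.minDegree = d ∧ G.maxDegree = D ∧
      kCoalitionNumber G 2 = (D - 2 * (d / 2) + 1) * (d / 2 + 1) + (d + 1) / 2 + 1 := by
  classical
  obtain ⟨m, rfl⟩ := hde
  have hm : 0 < m := by omega
  let σ : Fin (m + 1) → Fin (m + 1) := fun i => i + 1
  have hσ : ∀ i, σ i ≠ i := by
    intro i h
    have : (1 : Fin (m + 1)) = 0 := by simpa [σ] using h
    have := congrArg Fin.val this
    rw [Fin.val_one', Fin.val_zero, Nat.mod_eq_of_lt (by omega)] at this
    omega
  let j0 : Fin (D - 2 * m + 1) := 0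
  let G := C2.gr σ j0
  have hmin : ∀ v, 2 * m ≤ G.degree v := by
    rintro (⟨i, j, l, s⟩ | ⟨i, j⟩ | i)
    · simpa using C2.le_deg_g σ j0 i j l s
    · simpa using C2.le_deg_b σ j0 i j
    · have := C2.deg_v σ j0 i (hσ i)
      simp only [Fintype.card_fin] at this
      show 2 * m ≤ (C2.gr σ j0).degree _
      omega
  have hmax : ∀ v, G.degree v ≤ D := by
    rintro (⟨i, j, l, s⟩ | ⟨i, j⟩ | i)
    · have := C2.deg_g_le σ j0 i j l s
      simp only [Fintype.card_fin] at this
      show (C2.gr σ j0).degree _ ≤ D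
      omega
    · have := C2.deg_b_le σ j0 i j
      simp only [Fintype.card_fin] at this
      show (C2.gr σ j0).degree _ ≤ D
      omega
    · have := C2.deg_v σ j0 i (hσ i)
      simp only [Fintype.card_fin] at this
      show (C2.gr σ j0).degree _ ≤ D
      omega
  have hx : G.degree (.inl (0, j0, σ 0, true)) = 2 * m :=
    le_antisymm (by simpa using C2.deg_x_le σ j0 0 (hσ 0)) (hmin _)
  have hvD : G.degree (.inr (.inr 0)) = D := by
    have := C2.deg_v σ j0 0 (hσ 0)
    simp only [Fintype.card_fin] at this
    show (C2.gr σ j0).degree _ = D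
    omega
  haveI : Nonempty (C2.W (Fin (m + 1)) (Fin (D - 2 * m + 1))) := ⟨.inr (.inr 0)⟩
  refine ⟨C2.W (Fin (m + 1)) (Fin (D - 2 * m + 1)), inferInstance, G, inferInstance, ?_, ?_, ?_⟩
  · refine le_antisymm ?_ (G.le_minDegree_of_forall_le_degree _ (fun v => by
      have := hmin v; omega))
    have := G.minDegree_le_degree (.inl (0, j0, σ 0, true))
    omega
  · refine le_antisymm (G.maxDegree_le_of_forall_degree_le _ hmax) ?_
    have := G.degree_le_maxDegree (.inr (.inr 0))
    omega
  · have e1 : (m + m) / 2 = m := by omega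
    have e2 : (m + m + 1) / 2 = m := by omega
    rw [e1, e2]
    have e3 : (D - 2 * m + 1) * (m + 1) + m + 1 = (m + 1) * (D - 2 * m + 2) := by ring
    rw [e3]
    refine IsGreatest.csSup_eq ⟨?_, ?_⟩
    · obtain ⟨P, hP, hc⟩ := C2.lower σ j0 hσ
      refine ⟨P, hP, ?_⟩
      rw [hc]
      simp only [Fintype.card_fin]
      ring
    · rintro n ⟨P, hP, rfl⟩
      exact C2.upper G m D (by omega) _ hx hmax P hP
end

section
/- Let T be a tree of order n ≥ 2. Then C_2(T) = ⌊n/2⌋ + 1 if and only if T is isomorphic to one of the following five trees: the paths P_2, P_3, P_4, P_5, or the double star S_{1,2}. -/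
open SimpleGraph

/-- The double star `S_{1,2}`: the tree with two adjacent non-leaf vertices, one with
one leaf neighbor and the other with two leaf neighbors. -/
def doubleStarOneTwo : SimpleGraph (Fin 5) :=
  SimpleGraph.fromEdgeSet {s(0, 1), s(0, 2), s(1, 3), s(1, 4)}


open Classical in
lemma sum_deg_aux {V : Type*} [Fintype V] (T : SimpleGraph V) (hT : T.IsTree)
    (hn : 2 ≤ Fintype.card V) (S : Finset V) :
    (∀ v, 1 ≤ T.degree v) ∧ ∑ v ∈ S, (T.degree v - 1) + 2 ≤ Fintype.card V ∧
      ∃ v, T.degree v = 1 := by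
  have : Nontrivial V := Fintype.one_lt_card_iff_nontrivial.mp (by omega)
  have h1 : ∀ v, 1 ≤ T.degree v := fun v => hT.1.preconnected.degree_pos_of_nontrivial v
  have h2 := T.sum_degrees_eq_twice_card_edges
  have h3 := hT.card_edgeFinset
  have h4 : ∑ v, (T.degree v - 1) + Fintype.card V = ∑ v, T.degree v := by
    have : Fintype.card V = ∑ v : V, 1 := by simp
    rw [this, ← Finset.sum_add_distrib]
    exact Finset.sum_congr rfl fun v _ => by have := h1 v; omega
  have h5 : ∑ v ∈ S, (T.degree v - 1) ≤ ∑ v, (T.degree v - 1) :=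
    Finset.sum_le_sum_of_subset (Finset.subset_univ S)
  refine ⟨h1, by omega, ?_⟩
  by_contra! h
  have h6 : ∑ v : V, 1 ≤ ∑ v, (T.degree v - 1) :=
    Finset.sum_le_sum fun v _ => by have := h1 v; have := h v; omega
  simp at h6
  omega

open Classical in
lemma ncard_aux {V : Type*} [Fintype V] (T : SimpleGraph V) (S : Set V)
    [DecidablePred (· ∈ S)] (v : V) :
    (S ∩ T.neighborSet v).ncard = ((T.neighborFinset v).filter (· ∈ S)).card := by
  rw [← Set.ncard_coe_finset]
  congr 1
  ext x
  simp [and_comm]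

open Classical in
lemma leaf_mem {V : Type*} [Fintype V] (T : SimpleGraph V) (S : Set V) (v : V)
    (hS : KDominatingSet T 2 S) (hv : T.degree v ≤ 1) : v ∈ S := by
  by_contra h
  have := hS v h
  rw [ncard_aux] at this
  have h2 := Finset.card_filter_le (T.neighborFinset v) (· ∈ S)
  rw [card_neighborFinset_eq_degree] at h2
  omega

open Classical in
lemma main_aux {V : Type*} [Fintype V] (T : SimpleGraph V) (hT : T.IsTree)
    (hn : 2 ≤ Fintype.card V) (P : Finset (Set V)) (hP : KCoalitionPartition T 2 P) :
    P.card ≤ 2 ∨ (P.card = 3 ∧ ∃ a b, a ≠ b ∧ 2 ≤ T.degree a ∧ 2 ≤ T.degree b) ∨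
      2 * P.card ≤ Fintype.card V := by
  obtain ⟨hne, hdis, hcov, hco⟩ := hP
  by_cases hm : P.card ≤ 2
  · exact Or.inl hm
  right
  have uniq : ∀ X ∈ P, ∀ Y ∈ P, ∀ x, x ∈ X → x ∈ Y → X = Y := by
    intro X hX Y hY x hx hy
    by_contra hXY
    exact Set.disjoint_left.mp (hdis hX hY hXY) hx hy
  have part : ∀ x, ∃ X ∈ P, x ∈ X := by
    intro x
    have : x ∈ ⋃ A ∈ P, A := by rw [hcov]; trivial
    simpa using this
  obtain ⟨hpos, -, l, hl⟩ := sum_deg_aux T hT hn ∅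
  obtain ⟨A, hA, hlA⟩ := part l
  have key : ∀ X ∈ P, X ≠ A → ¬ KDominatingSet T 2 A ∧ KDominatingSet T 2 (A ∪ X) := by
    intro X hX hXA
    rcases hco X hX with ⟨h, -⟩ | ⟨Y, hY, -, -, -, h1, h2⟩
    · exact absurd (uniq X hX A hA l (leaf_mem T X l h hl.le) hlA) hXA
    · rcases leaf_mem T _ l h2 hl.le with h | h
      · exact absurd (uniq X hX A hA l h hlA) hXA
      · obtain rfl := uniq Y hY A hA l h hlA
        exact ⟨h1, by rwa [Set.union_comm]⟩
  have hRcard : (P.erase A).card = P.card - 1 := Finset.card_erase_of_mem hA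
  have leafA : ∀ x, T.degree x ≤ 1 → x ∈ A := by
    intro x hx
    obtain ⟨X, hX, Y, hY, hXY⟩ := Finset.one_lt_card.mp (show 1 < (P.erase A).card by omega)
    rw [Finset.mem_erase] at hX hY
    rcases leaf_mem T _ x (key X hX.2 hX.1).2 hx with h | h
    · exact h
    rcases leaf_mem T _ x (key Y hY.2 hY.1).2 hx with h' | h'
    · exact h'
    exact absurd (uniq X hX.2 Y hY.2 x h h') hXY
  obtain ⟨X, hX, Y, hY, hXY⟩ := Finset.one_lt_card.mp (show 1 < (P.erase A).card by omega)
  rw [Finset.mem_erase] at hX hY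
  by_cases hm3 : P.card = 3
  · left
    refine ⟨hm3, ?_⟩
    obtain ⟨a, ha⟩ := hne X hX.2
    obtain ⟨b, hb⟩ := hne Y hY.2
    refine ⟨a, b, ?_, ?_, ?_⟩
    · rintro rfl
      exact hXY (uniq X hX.2 Y hY.2 a ha hb)
    · by_contra h
      exact hX.1 (uniq X hX.2 A hA a ha (leafA a (by omega)))
    · by_contra h
      exact hY.1 (uniq Y hY.2 A hA b hb (leafA b (by omega)))
  right
  have hnA := (key X hX.2 hX.1).1
  unfold KDominatingSet at hnA
  push Not at hnA
  obtain ⟨v, hvA, hv⟩ := hnA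
  obtain ⟨B0, hB0, hvB0⟩ := part v
  have hB0A : B0 ≠ A := by rintro rfl; exact hvA hvB0
  set Q := (P.erase A).erase B0 with hQ
  have hQcard : Q.card = P.card - 2 := by
    rw [hQ, Finset.card_erase_of_mem (Finset.mem_erase.mpr ⟨hB0A, hB0⟩)]; omega
  have memQ : ∀ B ∈ Q, B ∈ P ∧ B ≠ A ∧ B ≠ B0 := by
    intro B hB
    simp only [hQ, Finset.mem_erase] at hB
    exact ⟨hB.2.2, hB.2.1, hB.1⟩
  rw [ncard_aux] at hv
  set N := T.neighborFinset v with hN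
  set a := (N.filter (· ∈ A)).card with ha
  set W := N.filter (· ∉ A) with hW
  have hdeg : a + W.card = T.degree v := by
    rw [← card_neighborFinset_eq_degree]
    exact Finset.card_filter_add_card_filter_not (s := N) (· ∈ A)
  have vnot : ∀ B ∈ Q, v ∉ A ∪ B := by
    intro B hB h
    obtain ⟨h1, h2, h3⟩ := memQ B hB
    rcases h with h | h
    · exact hvA h
    · exact h3 (uniq B h1 B0 hB0 v h hvB0)
  have each : ∀ B ∈ Q, 2 - a ≤ (N.filter (· ∈ B)).card := by
    intro B hB
    obtain ⟨h1, h2, h3⟩ := memQ B hB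
    have h4 := (key B h1 h2).2 v (vnot B hB)
    rw [ncard_aux] at h4
    have h5 : N.filter (· ∈ A ∪ B) = N.filter (· ∈ A) ∪ N.filter (· ∈ B) := by
      ext x; simp; tauto
    rw [← hN, h5] at h4
    have := Finset.card_union_le (N.filter (· ∈ A)) (N.filter (· ∈ B))
    omega
  have hWc : Q.card * (2 - a) ≤ W.card := by
    have h1 : (Q.biUnion fun B => N.filter (· ∈ B)).card = ∑ B ∈ Q, (N.filter (· ∈ B)).card := by
      apply Finset.card_biUnion
      intro B hB C hC hBC
      refine Finset.disjoint_left.mpr ?_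
      intro x hx hy
      exact hBC (uniq B (memQ B hB).1 C (memQ C hC).1 x (Finset.mem_filter.mp hx).2
        (Finset.mem_filter.mp hy).2)
    have h2 : (Q.biUnion fun B => N.filter (· ∈ B)) ⊆ W := by
      intro x hx
      simp only [Finset.mem_biUnion, Finset.mem_filter] at hx
      obtain ⟨B, hB, hx1, hx2⟩ := hx
      refine Finset.mem_filter.mpr ⟨hx1, fun h => ?_⟩
      exact (memQ B hB).2.1 (uniq B (memQ B hB).1 A hA x hx2 h)
    have h3 := Finset.card_le_card h2
    have h4 := Finset.card_nsmul_le_sum Q _ _ each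
    rw [smul_eq_mul] at h4
    omega
  have hW3 : ∀ w ∈ W, 2 ≤ T.degree w - 1 := by
    intro w hw
    obtain ⟨hw1, hw2⟩ := Finset.mem_filter.mp hw
    obtain ⟨Bw, hBw, hwB⟩ := part w
    have : ∃ B ∈ Q, B ≠ Bw := Finset.exists_mem_ne (by omega) Bw
    obtain ⟨B, hB, hBne⟩ := this
    have h1 : w ∉ A ∪ B := by
      rintro (h | h)
      · exact hw2 h
      · exact hBne (uniq B (memQ B hB).1 Bw hBw w h hwB)
    have h2 := (key B (memQ B hB).1 (memQ B hB).2.1).2 w h1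
    rw [ncard_aux] at h2
    have h3 : (T.neighborFinset w).filter (· ∈ A ∪ B) ⊂ T.neighborFinset w := by
      rw [Finset.filter_ssubset]
      refine ⟨v, ?_, vnot B hB⟩
      rw [mem_neighborFinset] at hw1 ⊢
      exact hw1.symm
    have h4 := Finset.card_lt_card h3
    rw [card_neighborFinset_eq_degree] at h4
    omega
  have hvW : v ∉ W := by simp [hW, hN]
  have hs := (sum_deg_aux T hT hn (insert v W)).2.1
  rw [Finset.sum_insert hvW] at hs
  have h4 := Finset.card_nsmul_le_sum W _ _ hW3
  rw [smul_eq_mul] at h4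
  have ha2 : a = 0 ∨ a = 1 := by omega
  have := hpos v
  rcases ha2 with h | h <;> rw [h] at hWc hdeg <;> omega

/-- Attach a new leaf (the vertex `none`) to the vertex `i` of `H`. -/
def attachLeaf {n : ℕ} (H : SimpleGraph (Fin n)) (i : Fin n) : SimpleGraph (Option (Fin n)) where
  Adj x y := match x, y with
    | none, none => False
    | none, some b => b = i
    | some a, none => a = i
    | some a, some b => H.Adj a b
  symm := ⟨by
    rintro (_ | a) (_ | b) h
    · exact h
    · exact h
    · exact h
    · exact h.symm⟩
  loopless := ⟨by
    rintro (_ | a) h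
    · exact h
    · exact H.irrefl h⟩

open Classical in
lemma attach_step {V : Type*} [Fintype V] (T : SimpleGraph V) (hT : T.IsTree) (n : ℕ)
    (hn : 1 ≤ n) (hc : Fintype.card V = n + 1) :
    ∃ (U : Set V), Fintype.card U = n ∧ (T.induce U).IsTree ∧
      ∀ H : SimpleGraph (Fin n), Nonempty (T.induce U ≃g H) →
        ∃ i, Nonempty (T ≃g attachLeaf H i) := by
  obtain ⟨-, -, l, hl⟩ := sum_deg_aux T hT (by omega) ∅
  refine ⟨{l}ᶜ, ?_, ⟨hT.1.induce_compl_singleton_of_degree_eq_one hl, hT.2.induce _⟩, ?_⟩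
  · have := Fintype.card_compl_set ({l} : Set V)
    rw [Fintype.card_eq_nat_card] at this ⊢
    rw [this]; simp [hc]
  rintro H ⟨e⟩
  obtain ⟨u, hu, huniq⟩ := degree_eq_one_iff_existsUnique_adj.mp hl
  have hul : u ∈ ({l}ᶜ : Set V) := by simpa using hu.ne'
  refine ⟨e ⟨u, hul⟩, ⟨⟨⟨fun x => if h : x = l then none else some (e ⟨x, h⟩),
    fun y => match y with
      | none => l
      | some a => (e.symm a).1, ?_, ?_⟩, ?_⟩⟩⟩
  · intro x
    by_cases h : x = l <;> simp [h]
  · rintro (_ | a)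
    · simp
    · have : (e.symm a).1 ≠ l := (e.symm a).2
      simp only [this, dite_false]
      exact congrArg some (e.apply_symm_apply a)
  · intro x y
    have adjl : ∀ z, T.Adj l z ↔ z = u := fun z => ⟨huniq z, by rintro rfl; exact hu⟩
    by_cases hx : x = l <;> by_cases hy : y = l
    · simp [hx, hy, attachLeaf]
    · subst hx
      simp [hy, attachLeaf, adjl]
      exact Subtype.mk_eq_mk
    · subst hy
      simp [hx, attachLeaf, T.adj_comm x, adjl]
      exact Subtype.mk_eq_mk
    · simp [hx, hy, attachLeaf]
      exact e.map_adj_iff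

/-- The star `K_{1,3}`. -/
def starThree : SimpleGraph (Fin 4) where
  Adj x y := x ≠ y ∧ (x = 0 ∨ y = 0)
  symm := ⟨fun _ _ h => ⟨h.1.symm, h.2.symm⟩⟩
  loopless := ⟨fun _ h => h.1 rfl⟩

/-- The star `K_{1,4}`. -/
def starFour : SimpleGraph (Fin 5) where
  Adj x y := x ≠ y ∧ (x = 0 ∨ y = 0)
  symm := ⟨fun _ _ h => ⟨h.1.symm, h.2.symm⟩⟩
  loopless := ⟨fun _ h => h.1 rfl⟩

instance (n : ℕ) : DecidableRel (pathGraph n).Adj := fun _ _ =>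
  decidable_of_iff _ pathGraph_adj.symm

instance : DecidableRel starThree.Adj := fun x y =>
  inferInstanceAs (Decidable (x ≠ y ∧ (x = 0 ∨ y = 0)))

instance : DecidableRel starFour.Adj := fun x y =>
  inferInstanceAs (Decidable (x ≠ y ∧ (x = 0 ∨ y = 0)))

instance : DecidableRel doubleStarOneTwo.Adj := fun x y =>
  decidable_of_iff ((s(x, y) = s(0, 1) ∨ s(x, y) = s(0, 2) ∨ s(x, y) = s(1, 3) ∨
    s(x, y) = s(1, 4)) ∧ x ≠ y) (by
      simp only [doubleStarOneTwo, fromEdgeSet_adj, Set.mem_insert_iff, Set.mem_singleton_iff])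

instance {n : ℕ} (H : SimpleGraph (Fin n)) [DecidableRel H.Adj] (i : Fin n) :
    DecidableRel (attachLeaf H i).Adj := fun x y => match x, y with
    | none, none => inferInstanceAs (Decidable False)
    | none, some b => inferInstanceAs (Decidable (b = i))
    | some a, none => inferInstanceAs (Decidable (a = i))
    | some a, some b => inferInstanceAs (Decidable (H.Adj a b))

/-- Criterion for an explicit isomorphism, given by the images of `none` and of `some j`. -/
lemma iso_attach {n : ℕ} (H : SimpleGraph (Fin n)) (i : Fin n) (K : SimpleGraph (Fin (n + 1)))
    (a : Fin (n + 1)) (f : Fin n → Fin (n + 1))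
    (hinj : ∀ x y, f x = f y → x = y) (ha : ∀ x, f x ≠ a)
    (h1 : ∀ x y, K.Adj (f x) (f y) ↔ H.Adj x y) (h2 : ∀ x, K.Adj a (f x) ↔ x = i) :
    Nonempty (attachLeaf H i ≃g K) := by
  let g : Option (Fin n) → Fin (n + 1) := fun o => o.elim a f
  have hg : Function.Injective g := by
    rintro (_ | x) (_ | y) h
    · rfl
    · exact absurd h.symm (ha y)
    · exact absurd h (ha x)
    · exact congrArg some (hinj x y h)
  have hb : Function.Bijective g := by
    rw [Fintype.bijective_iff_injective_and_card]
    exact ⟨hg, by simp⟩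
  refine ⟨⟨Equiv.ofBijective g hb, ?_⟩⟩
  rintro (_ | x) (_ | y)
  · simp [g, attachLeaf]
  · simpa [g, attachLeaf] using h2 y
  · simpa [g, attachLeaf, K.adj_comm] using h2 x
  · simpa [g, attachLeaf] using h1 x y

lemma class_one {V : Type*} [Fintype V] (T : SimpleGraph V)
    (hc : Fintype.card V = 1) : Nonempty (T ≃g pathGraph 1) := by
  have : Subsingleton V := Fintype.card_le_one_iff_subsingleton.mp (by omega)
  obtain ⟨e⟩ := Fintype.card_eq.mp (show Fintype.card V = Fintype.card (Fin 1) by simp [hc])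
  refine ⟨⟨e, ?_⟩⟩
  intro x y
  obtain rfl := Subsingleton.elim x y
  simp

lemma class_two {V : Type*} [Fintype V] (T : SimpleGraph V) (hT : T.IsTree)
    (hc : Fintype.card V = 2) : Nonempty (T ≃g pathGraph 2) := by
  classical
  obtain ⟨U, hU, -, h⟩ := attach_step T hT 1 (by omega) hc
  obtain ⟨i, ⟨e⟩⟩ := h _ (class_one _ hU)
  obtain ⟨f⟩ : Nonempty (attachLeaf (pathGraph 1) i ≃g pathGraph 2) := by
    fin_cases i
    exact iso_attach _ _ _ 1 ![0] (by decide) (by decide) (by decide) (by decide)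
  exact ⟨e.trans f⟩

lemma class_three {V : Type*} [Fintype V] (T : SimpleGraph V) (hT : T.IsTree)
    (hc : Fintype.card V = 3) : Nonempty (T ≃g pathGraph 3) := by
  classical
  obtain ⟨U, hU, hU', h⟩ := attach_step T hT 2 (by omega) hc
  obtain ⟨i, ⟨e⟩⟩ := h _ (class_two _ hU' hU)
  obtain ⟨f⟩ : Nonempty (attachLeaf (pathGraph 2) i ≃g pathGraph 3) := by
    fin_cases i
    · exact iso_attach _ _ _ 0 ![1, 2] (by decide) (by decide) (by decide) (by decide)
    · exact iso_attach _ _ _ 2 ![0, 1] (by decide) (by decide) (by decide) (by decide)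
  exact ⟨e.trans f⟩

lemma class_four {V : Type*} [Fintype V] (T : SimpleGraph V) (hT : T.IsTree)
    (hc : Fintype.card V = 4) : Nonempty (T ≃g pathGraph 4) ∨ Nonempty (T ≃g starThree) := by
  classical
  obtain ⟨U, hU, hU', h⟩ := attach_step T hT 3 (by omega) hc
  obtain ⟨i, ⟨e⟩⟩ := h _ (class_three _ hU' hU)
  have : Nonempty (attachLeaf (pathGraph 3) i ≃g pathGraph 4) ∨
      Nonempty (attachLeaf (pathGraph 3) i ≃g starThree) := by
    fin_cases i
    · exact Or.inl (iso_attach _ _ _ 0 ![1, 2, 3] (by decide) (by decide) (by decide) (by decide))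
    · exact Or.inr (iso_attach _ _ _ 3 ![1, 0, 2] (by decide) (by decide) (by decide) (by decide))
    · exact Or.inl (iso_attach _ _ _ 3 ![0, 1, 2] (by decide) (by decide) (by decide) (by decide))
  exact this.imp (fun ⟨f⟩ => ⟨e.trans f⟩) (fun ⟨f⟩ => ⟨e.trans f⟩)

lemma class_five {V : Type*} [Fintype V] (T : SimpleGraph V) (hT : T.IsTree)
    (hc : Fintype.card V = 5) : Nonempty (T ≃g pathGraph 5) ∨
      Nonempty (T ≃g doubleStarOneTwo) ∨ Nonempty (T ≃g starFour) := by
  classical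
  obtain ⟨U, hU, hU', h⟩ := attach_step T hT 4 (by omega) hc
  rcases class_four _ hU' hU with h4 | h4
  · obtain ⟨i, ⟨e⟩⟩ := h _ h4
    have : Nonempty (attachLeaf (pathGraph 4) i ≃g pathGraph 5) ∨
        Nonempty (attachLeaf (pathGraph 4) i ≃g doubleStarOneTwo) := by
      fin_cases i
      · exact Or.inl (iso_attach _ _ _ 0 ![1, 2, 3, 4] (by decide) (by decide) (by decide)
          (by decide))
      · exact Or.inr (iso_attach _ _ _ 4 ![3, 1, 0, 2] (by decide) (by decide) (by decide)
          (by decide))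
      · exact Or.inr (iso_attach _ _ _ 4 ![2, 0, 1, 3] (by decide) (by decide) (by decide)
          (by decide))
      · exact Or.inl (iso_attach _ _ _ 4 ![0, 1, 2, 3] (by decide) (by decide) (by decide)
          (by decide))
    exact this.imp (fun ⟨f⟩ => ⟨e.trans f⟩) (fun ⟨f⟩ => Or.inl ⟨e.trans f⟩)
  · obtain ⟨i, ⟨e⟩⟩ := h _ h4
    right
    have : Nonempty (attachLeaf starThree i ≃g doubleStarOneTwo) ∨
        Nonempty (attachLeaf starThree i ≃g starFour) := by
      fin_cases i
      · exact Or.inr (iso_attach _ _ _ 4 ![0, 1, 2, 3] (by decide) (by decide) (by decide)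
          (by decide))
      · exact Or.inl (iso_attach _ _ _ 2 ![1, 0, 3, 4] (by decide) (by decide) (by decide)
          (by decide))
      · exact Or.inl (iso_attach _ _ _ 2 ![1, 3, 0, 4] (by decide) (by decide) (by decide)
          (by decide))
      · exact Or.inl (iso_attach _ _ _ 2 ![1, 3, 4, 0] (by decide) (by decide) (by decide)
          (by decide))
    exact this.imp (fun ⟨f⟩ => ⟨e.trans f⟩) (fun ⟨f⟩ => ⟨e.trans f⟩)

/-- A graph isomorphic to a star has no two distinct vertices of degree at least two. -/
lemma star_contra {V : Type*} [Fintype V] (T : SimpleGraph V) [DecidableRel T.Adj]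
    {n : ℕ} (K : SimpleGraph (Fin (n + 1)))
    (hK : ∀ x y, K.Adj x y → x = 0 ∨ y = 0) (e : T ≃g K) (a b : V) (hab : a ≠ b)
    (ha : 2 ≤ T.degree a) (hb : 2 ≤ T.degree b) : False := by
  have key : ∀ a, 2 ≤ T.degree a → e a = 0 := by
    intro a ha
    by_contra h0
    rw [← card_neighborFinset_eq_degree] at ha
    obtain ⟨x, hx, y, hy, hxy⟩ := Finset.one_lt_card.mp (show 1 < _ from ha)
    rw [mem_neighborFinset] at hx hy
    have h1 := (hK _ _ (e.map_adj_iff.mpr hx)).resolve_left h0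
    have h2 := (hK _ _ (e.map_adj_iff.mpr hy)).resolve_left h0
    exact hxy (e.injective (h1.trans h2.symm))
  exact hab (e.injective ((key a ha).trans (key b hb).symm))

lemma dom_iso {V W : Type*} [Fintype V] [Fintype W] (T : SimpleGraph V) (H : SimpleGraph W)
    (e : T ≃g H) (k : ℕ) (S : Set W) :
    KDominatingSet T k (e ⁻¹' S) ↔ KDominatingSet H k S := by
  have h : ∀ v, (e ⁻¹' S ∩ T.neighborSet v).ncard = (S ∩ H.neighborSet (e v)).ncard := by
    intro v
    rw [← Set.ncard_image_of_injective _ e.injective]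
    congr 1
    ext y
    constructor
    · rintro ⟨x, ⟨hx1, hx2⟩, rfl⟩
      exact ⟨hx1, e.map_adj_iff.mpr hx2⟩
    · rintro ⟨hy1, hy2⟩
      obtain ⟨x, rfl⟩ := e.surjective y
      exact ⟨x, ⟨hy1, e.map_adj_iff.mp hy2⟩, rfl⟩
  constructor
  · intro hd v hv
    obtain ⟨x, rfl⟩ := e.surjective v
    rw [← h]
    exact hd x hv
  · intro hd v hv
    rw [h]
    exact hd (e v) hv

/-- Decidable form of 2-domination. -/
lemma dom_dec {n : ℕ} (H : SimpleGraph (Fin n)) [DecidableRel H.Adj] (p : Fin n → Prop)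
    [DecidablePred p] :
    KDominatingSet H 2 {x | p x} ↔
      ∀ v, ¬ p v → 2 ≤ (Finset.univ.filter fun x => p x ∧ H.Adj v x).card := by
  have h : ∀ v, ({x | p x} ∩ H.neighborSet v).ncard =
      (Finset.univ.filter fun x => p x ∧ H.Adj v x).card := by
    intro v
    rw [← Set.ncard_coe_finset]
    congr 1
    ext x
    simp
  unfold KDominatingSet
  simp only [h]
  rfl

/-- A colouring of `H` with suitable colour classes gives a coalition partition of `T`. -/
lemma partition_of_colouring {V : Type*} [Fintype V] (T : SimpleGraph V) {n m : ℕ}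
    (H : SimpleGraph (Fin n)) [DecidableRel H.Adj] (e : T ≃g H) (c : Fin n → Fin m)
    (hs : ∀ i, ∃ x, c x = i)
    (h1 : ∀ i, ¬ ∀ v, ¬ c v = i → 2 ≤ (Finset.univ.filter fun x => c x = i ∧ H.Adj v x).card)
    (h2 : ∀ i, ∃ j, j ≠ i ∧ ∀ v, ¬ (c v = i ∨ c v = j) →
      2 ≤ (Finset.univ.filter fun x => (c x = i ∨ c x = j) ∧ H.Adj v x).card) :
    ∃ P : Finset (Set V), KCoalitionPartition T 2 P ∧ P.card = m := by
  classical
  let F : Fin m → Set V := fun i => e ⁻¹' {x | c x = i}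
  have hF : Function.Injective F := by
    intro i j hij
    obtain ⟨x, hx⟩ := hs i
    have : e.symm x ∈ F i := by simp [F, hx]
    rw [hij] at this
    simpa [F, hx] using this
  have hdis : ∀ i j, i ≠ j → Disjoint (F i) (F j) := by
    intro i j hij
    rw [Set.disjoint_left]
    intro x hx hy
    exact hij (Eq.trans (Eq.symm hx) hy)
  have hnd : ∀ i, ¬ KDominatingSet T 2 (F i) := by
    intro i
    rw [dom_iso T H e, dom_dec]
    exact h1 i
  refine ⟨Finset.univ.image F, ⟨?_, ?_, ?_, ?_⟩, ?_⟩
  · intro A hA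
    obtain ⟨i, -, rfl⟩ := Finset.mem_image.mp hA
    obtain ⟨x, hx⟩ := hs i
    exact ⟨e.symm x, by simp [F, hx]⟩
  · intro A hA B hB hAB
    obtain ⟨i, -, rfl⟩ := Finset.mem_image.mp hA
    obtain ⟨j, -, rfl⟩ := Finset.mem_image.mp hB
    exact hdis i j fun h => hAB (by rw [h])
  · ext x
    simp [F]
  · intro A hA
    obtain ⟨i, -, rfl⟩ := Finset.mem_image.mp hA
    obtain ⟨j, hji, hj⟩ := h2 i
    refine Or.inr ⟨F j, Finset.mem_image_of_mem _ (Finset.mem_univ _), fun h => hji (hF h),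
      hdis i j hji.symm, hnd i, hnd j, ?_⟩
    have : F i ∪ F j = e ⁻¹' {x | c x = i ∨ c x = j} := rfl
    rw [this, dom_iso T H e, dom_dec]
    exact hj
  · rw [Finset.card_image_of_injective _ hF]
    simp

lemma upper_bound {V : Type*} [Fintype V] (T : SimpleGraph V) (hT : T.IsTree)
    (hn : 2 ≤ Fintype.card V) (P : Finset (Set V)) (hP : KCoalitionPartition T 2 P) :
    P.card ≤ Fintype.card V / 2 + 1 := by
  classical
  rcases main_aux T hT hn P hP with h | ⟨h, a, b, hab, ha, hb⟩ | h
  · omega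
  · have := (sum_deg_aux T hT hn {a, b}).2.1
    rw [Finset.sum_pair hab] at this
    omega
  · omega

lemma number_eq {V : Type*} [Fintype V] (T : SimpleGraph V) (hT : T.IsTree)
    (hn : 2 ≤ Fintype.card V)
    (h : ∃ P : Finset (Set V), KCoalitionPartition T 2 P ∧ P.card = Fintype.card V / 2 + 1) :
    kCoalitionNumber T 2 = Fintype.card V / 2 + 1 := by
  apply IsGreatest.csSup_eq
  refine ⟨h, ?_⟩
  rintro m ⟨P, hP, rfl⟩
  exact upper_bound T hT hn P hP

lemma number_mem {V : Type*} [Fintype V] (T : SimpleGraph V) (hT : T.IsTree)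
    (hn : 2 ≤ Fintype.card V) (h : kCoalitionNumber T 2 = Fintype.card V / 2 + 1) :
    ∃ P : Finset (Set V), KCoalitionPartition T 2 P ∧ P.card = Fintype.card V / 2 + 1 := by
  have hne : {n | ∃ P : Finset (Set V), KCoalitionPartition T 2 P ∧ P.card = n}.Nonempty := by
    by_contra hne
    rw [Set.not_nonempty_iff_eq_empty] at hne
    rw [kCoalitionNumber, hne] at h
    simp at h
  have := Nat.sSup_mem hne ⟨Fintype.card V / 2 + 1, by
    rintro m ⟨P, hP, rfl⟩
    exact upper_bound T hT hn P hP⟩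
  obtain ⟨P, hP, hc⟩ := this
  exact ⟨P, hP, hc.trans h⟩

theorem c2_tree_eq_iff {V : Type*} [Fintype V] (T : SimpleGraph V) (hT : T.IsTree)
    (hn : 2 ≤ Fintype.card V) :
    kCoalitionNumber T 2 = Fintype.card V / 2 + 1 ↔
      Nonempty (T ≃g SimpleGraph.pathGraph 2) ∨
      Nonempty (T ≃g SimpleGraph.pathGraph 3) ∨
      Nonempty (T ≃g SimpleGraph.pathGraph 4) ∨
      Nonempty (T ≃g SimpleGraph.pathGraph 5) ∨
      Nonempty (T ≃g doubleStarOneTwo) := by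
  classical
  constructor
  · intro h
    obtain ⟨P, hP, hc⟩ := number_mem T hT hn h
    rcases main_aux T hT hn P hP with h | ⟨h, a, b, hab, ha, hb⟩ | h
    · have : Fintype.card V = 2 ∨ Fintype.card V = 3 := by omega
      rcases this with h | h
      · exact Or.inl (class_two T hT h)
      · exact Or.inr (Or.inl (class_three T hT h))
    · have : Fintype.card V = 4 ∨ Fintype.card V = 5 := by omega
      rcases this with h | h
      · rcases class_four T hT h with h | ⟨⟨e⟩⟩
        · exact Or.inr (Or.inr (Or.inl h))
        · exact (star_contra T starThree (fun _ _ h => h.2) e a b hab (by convert ha)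
            (by convert hb)).elim
      · rcases class_five T hT h with h | h | ⟨⟨e⟩⟩
        · exact Or.inr (Or.inr (Or.inr (Or.inl h)))
        · exact Or.inr (Or.inr (Or.inr (Or.inr h)))
        · exact (star_contra T starFour (fun _ _ h => h.2) e a b hab (by convert ha)
            (by convert hb)).elim
    · omega
  · intro h
    apply number_eq T hT hn
    have hcard : ∀ {n : ℕ} (H : SimpleGraph (Fin n)) (e : T ≃g H), Fintype.card V = n :=
      fun H e => by simpa using Fintype.card_congr e.toEquiv
    rcases h with ⟨⟨e⟩⟩ | ⟨⟨e⟩⟩ | ⟨⟨e⟩⟩ | ⟨⟨e⟩⟩ | ⟨⟨e⟩⟩ <;> rw [hcard _ e]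
    · exact partition_of_colouring T _ e ![0, 1] (by decide) (by decide) (by decide)
    · exact partition_of_colouring T _ e ![0, 1, 1] (by decide) (by decide) (by decide)
    · exact partition_of_colouring T _ e ![0, 1, 2, 0] (by decide) (by decide) (by decide)
    · exact partition_of_colouring T _ e ![0, 1, 2, 1, 0] (by decide) (by decide) (by decide)
    · exact partition_of_colouring T _ e ![1, 2, 0, 0, 0] (by decide) (by decide) (by decide)
end
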